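/- arXiv:1005.4206 — 4 statements merged into one kernel-verified Lean document; each statement's English description precedes it below -/
import Mathlib

section
/- Let t ≥ 1 and let χ be a nontrivial quadratic Dirichlet character modulo t (so χ² is the principal character but χ is not principal, and χ takes only the values 0, 1, −1). Let T be any finite set of prime numbers. Then there exists a real constant c > 0 such that for every odd prime p one has ∏_{q} q^{⌊pq/(q²−1)⌋ − 1} ≥ p^{p/2} / c^p, where the product is taken over all primes q ≤ p with χ(q) = −1 and q ∉ T. -/
open Finset Filter Topology
open scoped ArithmeticFunction.vonMangoldt

/-- **Abel's inequality** for a nonnegative antitone weight. -/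
theorem norm_sum_range_smul_le_of_antitone {E : Type*} [SeminormedAddCommGroup E] [NormedSpace ℝ E]
    {f : ℕ → ℝ} (hf : Antitone f) (hf0 : ∀ n, 0 ≤ f n) {z : ℕ → E} {B : ℝ}
    (hB : ∀ n, ‖∑ i ∈ range n, z i‖ ≤ B) (n : ℕ) :
    ‖∑ i ∈ range n, f i • z i‖ ≤ B * f 0 := by
  have key : ‖∑ i ∈ range n, f i • z i - f n • ∑ i ∈ range n, z i‖ ≤ B * (f 0 - f n) := by
    induction n with
    | zero => simp
    | succ n ih =>
      have hsplit : ∑ i ∈ range (n + 1), f i • z i - f (n + 1) • ∑ i ∈ range (n + 1), z i =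
          (∑ i ∈ range n, f i • z i - f n • ∑ i ∈ range n, z i) +
            (f n - f (n + 1)) • ∑ i ∈ range (n + 1), z i := by
        simp only [sum_range_succ]
        module
      have hdiff : 0 ≤ f n - f (n + 1) := sub_nonneg.2 (hf n.le_succ)
      calc _ ≤ B * (f 0 - f n) + (f n - f (n + 1)) * B := by
            rw [hsplit]
            refine (norm_add_le _ _).trans (add_le_add ih ?_)
            rw [norm_smul, Real.norm_of_nonneg hdiff]
            exact mul_le_mul_of_nonneg_left (hB _) hdiff
        _ = _ := by ring
  have hlast : ‖f n • ∑ i ∈ range n, z i‖ ≤ f n * B := by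
    rw [norm_smul, Real.norm_of_nonneg (hf0 n)]
    exact mul_le_mul_of_nonneg_left (hB _) (hf0 n)
  have := norm_le_norm_sub_add (∑ i ∈ range n, f i • z i) (f n • ∑ i ∈ range n, z i)
  linarith

namespace DirichletCharacter

variable {t : ℕ}

theorem sum_log_div_eq_sum_vonMangoldt_div (χ : DirichletCharacter ℂ t) (n : ℕ) :
    ∑ i ∈ Ioc 0 n, χ (i : ZMod t) * Real.log i / i =
      ∑ d ∈ Ioc 0 n, χ (d : ZMod t) * Λ d / d * ∑ m ∈ Ioc 0 (n / d), χ (m : ZMod t) / m := by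
  let f : ArithmeticFunction ℂ := ⟨fun d ↦ χ (d : ZMod t) * Λ d / d, by simp⟩
  let g : ArithmeticFunction ℂ := ⟨fun m ↦ χ (m : ZMod t) / m, by simp⟩
  refine Eq.trans (sum_congr rfl fun i _ ↦ ?_) (ArithmeticFunction.sum_Ioc_mul_eq_sum_sum f g n)
  rw [ArithmeticFunction.mul_apply, ← ArithmeticFunction.vonMangoldt_sum,
    ← Nat.sum_divisorsAntidiagonal (fun d _ ↦ Λ d)]
  push_cast
  rw [mul_sum, sum_div]
  refine sum_congr rfl fun x hx ↦ ?_
  rw [← (Nat.mem_divisorsAntidiagonal.1 hx).1]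
  simp only [f, g, ArithmeticFunction.coe_mk, Nat.cast_mul, map_mul]
  ring

variable [NeZero t] {χ : DirichletCharacter ℂ t}

theorem sum_range_modulus_eq_zero (hχ : χ ≠ 1) : ∑ i ∈ range t, χ (i : ZMod t) = 0 := by
  rw [← MulChar.sum_eq_zero_of_ne_one hχ]
  refine sum_bij' (fun i _ ↦ (i : ZMod t)) (fun a _ ↦ a.val) ?_ ?_ ?_ ?_ ?_
  · simp
  · intro a _
    simpa using ZMod.val_lt a
  · intro i hi
    exact ZMod.val_cast_of_lt (mem_range.1 hi)
  · simp
  · simp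

theorem norm_sum_range_le (hχ : χ ≠ 1) (n : ℕ) : ‖∑ i ∈ range n, χ (i : ZMod t)‖ ≤ t := by
  have hmod : ∑ i ∈ range n, χ (i : ZMod t) = ∑ i ∈ range (n % t), χ (i : ZMod t) := by
    have hmul : ∀ k m, ∑ i ∈ range (t * k + m), χ (i : ZMod t) =
        ∑ i ∈ range m, χ (i : ZMod t) := by
      intro k m
      induction k with
      | zero => simp
      | succ k ih =>
        rw [show t * (k + 1) + m = t + (t * k + m) by ring, sum_range_add,
          sum_range_modulus_eq_zero hχ, ← ih]
        simp
    conv_lhs => rw [← Nat.div_add_mod n t]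
    exact hmul _ _
  rw [hmod]
  calc _ ≤ ∑ i ∈ range (n % t), (1 : ℝ) :=
        norm_sum_le_of_le _ fun i _ ↦ χ.norm_le_one _
    _ ≤ t := by
        simpa using (Nat.mod_lt n (NeZero.pos t)).le

theorem norm_sum_range_add_le (hχ : χ ≠ 1) (m n : ℕ) :
    ‖∑ i ∈ range n, χ ((m + i : ℕ) : ZMod t)‖ ≤ 2 * t := by
  have h := sum_range_add (fun i : ℕ ↦ χ (i : ZMod t)) m n
  rw [eq_sub_iff_add_eq'.2 h.symm]
  refine (norm_sub_le _ _).trans ?_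
  linarith [norm_sum_range_le hχ (m + n), norm_sum_range_le hχ m]

theorem norm_sum_Ioc_smul_le (hχ : χ ≠ 1) {f : ℕ → ℝ} {m : ℕ}
    (hf : AntitoneOn f (Set.Ici (m + 1))) (hf0 : ∀ n, m < n → 0 ≤ f n) (n : ℕ) :
    ‖∑ i ∈ Ioc m n, f i • χ (i : ZMod t)‖ ≤ 2 * t * f (m + 1) := by
  have hI : Ioc m n = Ico (m + 1) (n + 1) := by ext; simp
  rw [hI, sum_Ico_eq_sum_range]
  exact norm_sum_range_smul_le_of_antitone (f := fun i ↦ f (m + 1 + i))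
    (fun a b hab ↦ hf (by simp) (by simp) (by omega)) (fun i ↦ hf0 _ (by omega))
    (norm_sum_range_add_le hχ (m + 1)) _

theorem norm_LFunction_sub_sum_le_of_one_lt (hχ : χ ≠ 1) (n : ℕ) {x : ℝ} (hx : 1 < x) :
    ‖LFunction χ x - ∑ i ∈ Ioc 0 n, ((i : ℝ) ^ (-x)) • χ (i : ZMod t)‖ ≤ 2 * t * (n + 1 : ℝ)⁻¹ := by
  have hs : 1 < (x : ℂ).re := by simpa
  have hsum := (LSeriesSummable_of_one_lt_re χ hs).LSeriesHasSum.tendsto_sum_nat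
  rw [← LFunction_eq_LSeries χ hs] at hsum
  have hterm (i : ℕ) (hi : i ≠ 0) :
      LSeries.term (χ ·) x i = ((i : ℝ) ^ (-x)) • χ (i : ZMod t) := by
    rw [LSeries.term_of_ne_zero hi, Complex.real_smul, Complex.ofReal_cpow (by positivity)]
    push_cast
    rw [Complex.cpow_neg, div_eq_mul_inv, mul_comm]
  refine le_of_tendsto ((hsum.comp (tendsto_add_atTop_nat 1)).sub_const _).norm ?_
  filter_upwards [eventually_ge_atTop n] with k hk
  have hrange : ∑ i ∈ range (k + 1), LSeries.term (χ ·) x i =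
      ∑ i ∈ Ioc 0 k, ((i : ℝ) ^ (-x)) • χ (i : ZMod t) := by
    rw [range_eq_Ico, sum_eq_sum_Ico_succ_bot (by omega), LSeries.term_zero, zero_add]
    refine sum_congr (by ext; simp; omega) fun i hi ↦ hterm i ?_
    have := (mem_Ioc.1 hi).1
    omega
  have hIoc := sum_Ioc_consecutive (fun i : ℕ ↦ ((i : ℝ) ^ (-x)) • χ (i : ZMod t)) n.zero_le hk
  simp only [Function.comp_apply]
  rw [hrange, ← hIoc, add_sub_cancel_left]
  refine (norm_sum_Ioc_smul_le hχ (f := fun i : ℕ ↦ (i : ℝ) ^ (-x)) ?_ ?_ k).trans ?_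
  · intro a ha b hb hab
    have : 0 < a := by simp at ha; omega
    exact Real.rpow_le_rpow_of_nonpos (by positivity) (by exact_mod_cast hab) (by linarith)
  · intro i _
    positivity
  · push_cast
    rw [← Real.rpow_neg_one]
    gcongr
    simp

theorem norm_LFunction_one_sub_sum_le (hχ : χ ≠ 1) (n : ℕ) :
    ‖LFunction χ 1 - ∑ i ∈ Ioc 0 n, χ (i : ZMod t) / i‖ ≤ 2 * t * (n + 1 : ℝ)⁻¹ := by
  have hL : Tendsto (fun x : ℝ ↦ LFunction χ x) (𝓝[>] 1) (𝓝 (LFunction χ 1)) := by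
    have : Continuous fun x : ℝ ↦ LFunction χ x :=
      (differentiable_LFunction hχ).continuous.comp Complex.continuous_ofReal
    simpa using (this.tendsto 1).mono_left nhdsWithin_le_nhds
  have hS : Tendsto (fun x : ℝ ↦ ∑ i ∈ Ioc 0 n, ((i : ℝ) ^ (-x)) • χ (i : ZMod t)) (𝓝[>] 1)
      (𝓝 (∑ i ∈ Ioc 0 n, χ (i : ZMod t) / i)) := by
    refine tendsto_finsetSum _ fun i hi ↦ ?_
    have hi : (i : ℝ) ≠ 0 := by
      have := (mem_Ioc.1 hi).1
      positivity
    have hc : Continuous fun x : ℝ ↦ ((i : ℝ) ^ (-x)) • χ (i : ZMod t) :=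
      (Real.continuous_const_rpow hi |>.comp continuous_neg).smul continuous_const
    have := (hc.tendsto 1).mono_left (nhdsWithin_le_nhds (s := Set.Ioi 1))
    rwa [Real.rpow_neg_one, Complex.real_smul, Complex.ofReal_inv, Complex.ofReal_natCast,
      mul_comm, ← div_eq_mul_inv] at this
  exact le_of_tendsto (hL.sub hS).norm
    (eventually_nhdsWithin_of_forall fun x hx ↦ norm_LFunction_sub_sum_le_of_one_lt hχ n hx)

theorem exists_norm_sum_log_div_le (hχ : χ ≠ 1) :
    ∃ C : ℝ, ∀ n : ℕ, ‖∑ i ∈ Ioc 0 n, χ (i : ZMod t) * Real.log i / i‖ ≤ C := by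
  set g : ℕ → ℂ := fun i ↦ χ (i : ZMod t) * Real.log i / i
  have htail (n : ℕ) : ‖∑ i ∈ Ioc 2 n, g i‖ ≤ 2 * t * (Real.log 3 / 3) := by
    have h := norm_sum_Ioc_smul_le hχ (f := fun i : ℕ ↦ Real.log i / i) (m := 2) ?_ ?_ n
    · have hsum : ∑ i ∈ Ioc 2 n, g i = ∑ i ∈ Ioc 2 n, (Real.log i / i) • χ (i : ZMod t) := by
        refine sum_congr rfl fun i _ ↦ ?_
        simp only [g, Complex.real_smul]
        push_cast
        ring
      rw [hsum]
      exact_mod_cast h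
    · intro a ha b hb hab
      have hle : ∀ c : ℕ, c ∈ Set.Ici (2 + 1) → (c : ℝ) ∈ Set.Ici (Real.exp 1) := fun c hc ↦
        Real.exp_one_lt_three.le.trans (by exact_mod_cast hc)
      exact Real.log_div_self_antitoneOn (hle a ha) (hle b hb) (by exact_mod_cast hab)
    · intro i _
      positivity
  refine ⟨∑ i ∈ Ioc 0 2, ‖g i‖ + 2 * t * (Real.log 3 / 3), fun n ↦ ?_⟩
  rcases le_total n 2 with hn | hn
  · have h : ∑ i ∈ Ioc 0 n, ‖g i‖ ≤ ∑ i ∈ Ioc 0 2, ‖g i‖ :=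
      sum_le_sum_of_subset_of_nonneg (Ioc_subset_Ioc_right hn) fun _ _ _ ↦ norm_nonneg _
    exact (norm_sum_le _ _).trans (h.trans (le_add_of_nonneg_right (by positivity)))
  · rw [← sum_Ioc_consecutive g (Nat.zero_le 2) hn]
    exact (norm_add_le _ _).trans (add_le_add (norm_sum_le _ _) (htail n))

/-- **Mertens' estimate** for a nontrivial Dirichlet character. -/
theorem exists_norm_sum_vonMangoldt_div_le (hχ : χ ≠ 1) :
    ∃ C : ℝ, ∀ n : ℕ, ‖∑ i ∈ Ioc 0 n, χ (i : ZMod t) * Λ i / i‖ ≤ C := by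
  obtain ⟨C, hC⟩ := exists_norm_sum_log_div_le hχ
  have hL : 0 < ‖LFunction χ 1‖ := norm_pos_iff.2 (LFunction_apply_one_ne_zero hχ)
  refine ⟨(2 * t * (Real.log 4 + 4) + C) / ‖LFunction χ 1‖, fun n ↦ ?_⟩
  rw [le_div_iff₀ hL, ← norm_mul]
  refine (norm_le_norm_sub_add _ (∑ i ∈ Ioc 0 n, χ (i : ZMod t) * Real.log i / i)).trans
    (add_le_add ?_ (hC n))
  rcases Nat.eq_zero_or_pos n with rfl | hn
  · simp only [Ioc_self, sum_empty, zero_mul, sub_zero, norm_zero]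
    positivity
  have hn' : (0 : ℝ) < n := by exact_mod_cast hn
  rw [sum_log_div_eq_sum_vonMangoldt_div, sum_mul, ← sum_sub_distrib]
  calc _ ≤ ∑ d ∈ Ioc 0 n, Λ d * (2 * t / n) := by
        refine norm_sum_le_of_le _ fun d hd ↦ ?_
        have hd0 : (0 : ℝ) < d := by exact_mod_cast (mem_Ioc.1 hd).1
        have hdn : (n : ℝ) ≤ d * ((n / d : ℕ) + 1) := by
          exact_mod_cast (Nat.lt_mul_div_succ n (mem_Ioc.1 hd).1).le
        have hΛ : 0 ≤ Λ d := ArithmeticFunction.vonMangoldt_nonneg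
        rw [← mul_sub, norm_mul, norm_div, norm_mul, Complex.norm_real, Complex.norm_natCast,
          Real.norm_of_nonneg hΛ]
        calc _ ≤ 1 * Λ d / d * (2 * t * ((n / d : ℕ) + 1 : ℝ)⁻¹) := by
              gcongr
              · exact χ.norm_le_one _
              · exact norm_LFunction_one_sub_sum_le hχ _
          _ = Λ d * (2 * t / (d * ((n / d : ℕ) + 1))) := by
              field_simp
          _ ≤ _ := by gcongr
    _ = Chebyshev.psi n * (2 * t / n) := by
        rw [← sum_mul, Chebyshev.psi, Nat.floor_natCast]
    _ ≤ (Real.log 4 + 4) * n * (2 * t / n) := by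
        gcongr
        exact Chebyshev.psi_le_const_mul_self hn'.le
    _ = _ := by field_simp

end DirichletCharacter

theorem log_sub_one_le_sum_vonMangoldt_div {n : ℕ} (hn : n ≠ 0) :
    Real.log n - 1 ≤ ∑ i ∈ Ioc 0 n, Λ i / i := by
  have hn' : (0 : ℝ) < n := by positivity
  have hlog : Real.log n.factorial = ∑ d ∈ Ioc 0 n, Λ d * (n / d : ℕ) := by
    rw [← ArithmeticFunction.sum_Ioc_mul_zeta_eq_sum, ArithmeticFunction.vonMangoldt_mul_zeta,
      ← prod_range_add_one_eq_factorial, Nat.cast_prod, Real.log_prod fun i _ ↦ by positivity,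
      range_eq_Ico, sum_Ico_add' (fun i : ℕ ↦ Real.log i)]
    refine sum_congr (by ext; simp; omega) fun i _ ↦ by simp
  have hle : Real.log n.factorial ≤ n * ∑ i ∈ Ioc 0 n, Λ i / i := by
    rw [hlog, mul_sum]
    refine sum_le_sum fun d _ ↦ ?_
    rw [mul_div_left_comm]
    exact mul_le_mul_of_nonneg_left Nat.cast_div_le ArithmeticFunction.vonMangoldt_nonneg
  have hst := Stirling.le_log_factorial_stirling hn
  have h1 : 0 ≤ Real.log n := Real.log_natCast_nonneg n
  have h2 : 0 ≤ Real.log (2 * Real.pi) := Real.log_nonneg (by linarith [Real.pi_gt_three])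
  refine le_of_mul_le_mul_left ?_ hn'
  linarith

theorem exists_sum_vonMangoldt_div_not_prime_le :
    ∃ C : ℝ, ∀ n : ℕ, ∑ i ∈ Ioc 0 n, (if i.Prime then 0 else Λ i) / (i : ℝ) ≤ C := by
  have h : Summable fun i : ℕ ↦ (if i.Prime then 0 else Λ i) / (i : ℝ) := by
    convert! ArithmeticFunction.vonMangoldt.summable_residueClass_non_primes_div (q := 1) 0 using 4
    simp [ArithmeticFunction.vonMangoldt.residueClass, Subsingleton.elim _ (0 : ZMod 1)]
  refine ⟨_, fun n ↦ h.sum_le_tsum _ fun i _ ↦ div_nonneg ?_ i.cast_nonneg⟩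
  split_ifs
  exacts [le_rfl, ArithmeticFunction.vonMangoldt_nonneg]

/-- A nontrivial real character takes the value `-1` on primes of logarithmic density at least one
half, up to any finite set of exceptions. -/
theorem exists_half_log_sub_le_sum_log_div {t : ℕ} [NeZero t] {χ : DirichletCharacter ℝ t}
    (hχ : χ ≠ 1) (hχval : ∀ a : ZMod t, χ a = 0 ∨ χ a = 1 ∨ χ a = -1) (T : Finset ℕ) :
    ∃ C : ℝ, ∀ n : ℕ, n ≠ 0 → Real.log n / 2 - C ≤
      ∑ q ∈ (range (n + 1)).filter (fun q : ℕ ↦ q.Prime ∧ χ (q : ZMod t) = -1 ∧ q ∉ T),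
        Real.log q / q := by
  have hχ' : χ.ringHomComp (algebraMap ℝ ℂ) ≠ 1 :=
    (MulChar.ringHomComp_ne_one_iff (algebraMap ℝ ℂ).injective).2 hχ
  obtain ⟨C₁, hC₁⟩ := DirichletCharacter.exists_norm_sum_vonMangoldt_div_le hχ'
  obtain ⟨C₂, hC₂⟩ := exists_sum_vonMangoldt_div_not_prime_le
  set U := T ∪ t.primeFactors
  set P : ℕ → Prop := fun q ↦ q.Prime ∧ χ (q : ZMod t) = -1 ∧ q ∉ T
  refine ⟨(1 + C₁) / 2 + C₂ + ∑ q ∈ U, Real.log q / q, fun n hn ↦ ?_⟩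
  have hχsum : |∑ i ∈ Ioc 0 n, χ (i : ZMod t) * Λ i / i| ≤ C₁ := by
    rw [← Real.norm_eq_abs, ← Complex.norm_real]
    simpa using hC₁ n
  have hterm (i : ℕ) (hi : 0 < i) : (1 - χ (i : ZMod t)) * Λ i / i ≤
      2 * (if P i then Real.log i / i else 0) + 2 * ((if i.Prime then 0 else Λ i) / (i : ℝ)) +
        2 * (if i ∈ U then Real.log i / i else 0) := by
    have hlog : 0 ≤ Real.log i / i := by positivity
    have hU : 0 ≤ if i ∈ U then Real.log i / i else 0 := by split_ifs <;> simp [hlog]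
    have hP : 0 ≤ if P i then Real.log i / i else 0 := by split_ifs <;> simp [hlog]
    have h2 : 1 - χ (i : ZMod t) ≤ 2 := by rcases hχval i with h | h | h <;> norm_num [h]
    have hdiv : 0 ≤ Λ i / i := div_nonneg ArithmeticFunction.vonMangoldt_nonneg i.cast_nonneg
    rw [mul_div_assoc]
    by_cases hp : i.Prime
    · rw [ArithmeticFunction.vonMangoldt_apply_prime hp] at hdiv ⊢
      simp only [hp, if_true, zero_div]
      by_cases hiU : i ∈ U
      · simp only [hiU, if_true]
        nlinarith
      by_cases hiP : P i
      · simp only [hiP, if_true]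
        nlinarith
      have hone : χ (i : ZMod t) = 1 := by
        simp only [U, mem_union, Nat.mem_primeFactors, not_or] at hiU
        have hunit : IsUnit (i : ZMod t) := by
          rw [ZMod.isUnit_iff_coprime, hp.coprime_iff_not_dvd]
          exact fun hd ↦ hiU.2 ⟨hp, hd, NeZero.ne t⟩
        rcases hχval i with h | h | h
        · exact absurd h (hunit.map χ).ne_zero
        · exact h
        · exact absurd ⟨hp, h, hiU.1⟩ hiP
      rw [show 1 - χ (i : ZMod t) = 0 by rw [hone, sub_self], zero_mul]
      linarith
    · simp only [hp, if_false]
      nlinarith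
  have hsumU : ∑ i ∈ Ioc 0 n, (if i ∈ U then Real.log i / i else 0) ≤
      ∑ q ∈ U, Real.log q / (q : ℝ) := by
    rw [← sum_filter]
    refine sum_le_sum_of_subset_of_nonneg (fun i hi ↦ (mem_filter.1 hi).2) fun i _ _ ↦ ?_
    positivity
  have hsumP : ∑ i ∈ Ioc 0 n, (if P i then Real.log i / i else 0) =
      ∑ q ∈ (range (n + 1)).filter P, Real.log q / (q : ℝ) := by
    rw [← sum_filter]
    refine sum_congr ?_ fun _ _ ↦ rfl
    ext i
    simp only [mem_filter, mem_Ioc, mem_range, Nat.lt_succ_iff]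
    exact ⟨fun h ↦ ⟨h.1.2, h.2⟩, fun h ↦ ⟨⟨h.2.1.pos, h.1⟩, h.2⟩⟩
  have hmain := sum_le_sum fun i (hi : i ∈ Ioc 0 n) ↦ hterm i (mem_Ioc.1 hi).1
  rw [sum_add_distrib, sum_add_distrib, ← mul_sum, ← mul_sum, ← mul_sum, hsumP] at hmain
  have hsplit : ∑ i ∈ Ioc 0 n, (1 - χ (i : ZMod t)) * Λ i / i =
      ∑ i ∈ Ioc 0 n, Λ i / i - ∑ i ∈ Ioc 0 n, χ (i : ZMod t) * Λ i / i := by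
    rw [← sum_sub_distrib]
    exact sum_congr rfl fun i _ ↦ by ring
  linarith [hC₂ n, log_sub_one_le_sum_vonMangoldt_div hn, (abs_le.1 hχsum).2]

theorem div_sub_two_le_natCast_mul_div_sub_one (p : ℕ) {q : ℕ} (hq : 2 ≤ q) :
    (p : ℝ) / q - 2 ≤ (p * q / (q ^ 2 - 1) - 1 : ℕ) := by
  have hsub : ((p * q / (q ^ 2 - 1) : ℕ) : ℝ) ≤ (p * q / (q ^ 2 - 1) - 1 : ℕ) + 1 := by
    exact_mod_cast Nat.le_add_of_sub_le le_rfl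
  have hq1 : 1 < q ^ 2 := Nat.one_lt_pow two_ne_zero hq
  have hfloor : (p * q : ℝ) ≤ (q ^ 2 - 1) * ((p * q / (q ^ 2 - 1) : ℕ) + 1) := by
    have := (Nat.lt_mul_div_succ (p * q) (Nat.sub_pos_of_lt hq1)).le
    rw [← Nat.cast_le (α := ℝ)] at this
    push_cast [Nat.cast_sub hq1.le] at this
    exact this
  have hq0 : (0 : ℝ) < q := by positivity
  have hdiv : (p : ℝ) / q ≤ (p * q / (q ^ 2 - 1) : ℕ) + 1 := by
    rw [div_le_iff₀ hq0]
    refine le_of_mul_le_mul_right ?_ hq0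
    nlinarith
  linarith

/-- Let `χ` be a nontrivial quadratic Dirichlet character modulo `t ≥ 1`
(taking only the values `0, 1, -1`), and let `T` be a finite set of primes.  Then there is a
constant `c > 0` such that for every odd prime `p`,
`∏_{q ≤ p, q prime, χ(q) = -1, q ∉ T} q^(⌊pq/(q²-1)⌋ - 1) ≥ p^(p/2) / c^p`. -/
theorem stmt0 (t : ℕ) (ht : 1 ≤ t) (χ : DirichletCharacter ℝ t)
    (hχ2 : χ ^ 2 = 1) (hχ1 : χ ≠ 1)
    (hχval : ∀ a : ZMod t, χ a = 0 ∨ χ a = 1 ∨ χ a = -1)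
    (T : Finset ℕ) (hT : ∀ q ∈ T, Nat.Prime q) :
    ∃ c : ℝ, 0 < c ∧ ∀ p : ℕ, Nat.Prime p → Odd p →
      (∏ q ∈ (Finset.range (p + 1)).filter
          (fun q => Nat.Prime q ∧ χ (q : ZMod t) = -1 ∧ q ∉ T),
        (q : ℝ) ^ (p * q / (q ^ 2 - 1) - 1))
        ≥ (p : ℝ) ^ ((p : ℝ) / 2) / c ^ p := by
  have : NeZero t := ⟨by omega⟩
  obtain ⟨C, hC⟩ := exists_half_log_sub_le_sum_log_div hχ1 hχval T
  refine ⟨Real.exp (C + 2 * Real.log 4), Real.exp_pos _, fun p hp _ ↦ ?_⟩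
  have hp0 : (0 : ℝ) < p := by exact_mod_cast hp.pos
  set F := (range (p + 1)).filter (fun q ↦ Nat.Prime q ∧ χ (q : ZMod t) = -1 ∧ q ∉ T)
  have hprime (q : ℕ) (hq : q ∈ F) : q.Prime := (mem_filter.1 hq).2.1
  have hpos (q : ℕ) (hq : q ∈ F) : (0 : ℝ) < (q : ℝ) ^ (p * q / (q ^ 2 - 1) - 1) :=
    pow_pos (by exact_mod_cast (hprime q hq).pos) _
  have htheta : ∑ q ∈ F, Real.log q ≤ Real.log 4 * p := by
    refine le_trans ?_ (Chebyshev.theta_le_log4_mul_x hp0.le)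
    rw [Chebyshev.theta_eq_sum_primesLE_log]
    refine sum_le_sum_of_subset_of_nonneg (fun q hq ↦ ?_) fun q _ _ ↦ Real.log_natCast_nonneg q
    exact Nat.mem_primesLE.2 ⟨Nat.lt_succ_iff.1 (mem_range.1 (mem_filter.1 hq).1), hprime q hq⟩
  have hlower : p * ∑ q ∈ F, Real.log q / q - 2 * ∑ q ∈ F, Real.log q ≤
      ∑ q ∈ F, Real.log ((q : ℝ) ^ (p * q / (q ^ 2 - 1) - 1)) := by
    rw [mul_sum, mul_sum, ← sum_sub_distrib]
    refine sum_le_sum fun q hq ↦ ?_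
    rw [Real.log_pow]
    calc _ = ((p : ℝ) / q - 2) * Real.log q := by ring
      _ ≤ _ := mul_le_mul_of_nonneg_right
        (div_sub_two_le_natCast_mul_div_sub_one p (hprime q hq).two_le) (Real.log_natCast_nonneg q)
  rw [ge_iff_le, ← Real.log_le_log_iff (by positivity) (prod_pos hpos),
    Real.log_prod fun q hq ↦ (hpos q hq).ne', Real.log_div (by positivity) (by positivity),
    Real.log_rpow hp0, Real.log_pow, Real.log_exp]
  have hweighted := mul_le_mul_of_nonneg_left (hC p hp.ne_zero) hp0.le
  linarith
end

section
/- Let S be a set of prime numbers and let c₀ ≥ 0 be a real constant such that for all real x ≥ 2, | Σ_{q ∈ S, q ≤ x} (log q)/q − (log x)/2 | ≤ c₀, where the sum is over primes q ∈ S with q ≤ x. Then there exists a real constant c₁ > 0 such that for every odd prime p, ∏_{q ∈ S, q ≤ p} q^{⌊pq/(q²−1)⌋ − 1} ≥ p^{p/2} / c₁^p. -/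
open scoped Classical

theorem div_sub_two_le_natDiv_sub_one (p : ℕ) {q : ℕ} (hq : 2 ≤ q) :
    (p : ℝ) / q - 2 ≤ ((p * q / (q ^ 2 - 1) - 1 : ℕ) : ℝ) := by
  set N := p * q / (q ^ 2 - 1)
  have hq0 : (0 : ℝ) < q := by exact_mod_cast (by lia : 0 < q)
  have hpos : 0 < q ^ 2 - 1 := by
    have : 2 ^ 2 ≤ q ^ 2 := Nat.pow_le_pow_left hq 2
    lia
  have hlt : p * q < (q ^ 2 - 1) * (N + 1) := Nat.lt_mul_div_succ (p * q) hpos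
  have hle : p * q ≤ (N + 1) * q * q :=
    calc p * q ≤ (q ^ 2 - 1) * (N + 1) := hlt.le
      _ ≤ q ^ 2 * (N + 1) := Nat.mul_le_mul_right _ (Nat.sub_le _ _)
      _ = (N + 1) * q * q := by ring
  have hp : (p : ℝ) ≤ (N + 1) * q := by
    exact_mod_cast Nat.le_of_mul_le_mul_right hle (by lia)
  have hN : (N : ℝ) ≤ ((N - 1 : ℕ) : ℝ) + 1 := by
    exact_mod_cast (by lia : N ≤ N - 1 + 1)
  have := (div_le_iff₀ hq0).2 hp
  linarith

theorem sum_log_le_log_four_mul {s : Finset ℕ} {n : ℕ}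
    (hs : ∀ q ∈ s, q.Prime ∧ q ≤ n) : ∑ q ∈ s, Real.log q ≤ Real.log 4 * n := by
  refine le_trans ?_ (Chebyshev.theta_le_log4_mul_x n.cast_nonneg)
  rw [Chebyshev.theta_eq_sum_primesLE_log]
  exact Finset.sum_le_sum_of_subset_of_nonneg
    (fun q hq => Nat.mem_primesLE.2 ⟨(hs q hq).2, (hs q hq).1⟩)
    fun q _ _ => Real.log_natCast_nonneg q

/-- Let `S` be a set of primes satisfying a Mertens-type estimate
`|∑_{q ∈ S, q ≤ x} (log q)/q - (log x)/2| ≤ c₀` for all `x ≥ 2`.  Then there is a constant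
`c₁ > 0` such that for every odd prime `p`,
`∏_{q ∈ S, q ≤ p} q^(⌊pq/(q²-1)⌋ - 1) ≥ p^(p/2) / c₁^p`. -/
theorem stmt2 (S : Set ℕ) (hS : ∀ q ∈ S, Nat.Prime q) (c₀ : ℝ) (hc₀ : 0 ≤ c₀)
    (hmertens : ∀ x : ℝ, 2 ≤ x →
      |(∑ q ∈ (Finset.range (⌊x⌋₊ + 1)).filter (fun q => q ∈ S ∧ (q : ℝ) ≤ x),
          Real.log q / q) - Real.log x / 2| ≤ c₀) :
    ∃ c₁ : ℝ, 0 < c₁ ∧ ∀ p : ℕ, Nat.Prime p → Odd p →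
      (∏ q ∈ (Finset.range (p + 1)).filter (fun q => q ∈ S),
        (q : ℝ) ^ (p * q / (q ^ 2 - 1) - 1))
        ≥ (p : ℝ) ^ ((p : ℝ) / 2) / c₁ ^ p := by
  refine ⟨Real.exp (c₀ + 2 * Real.log 4), Real.exp_pos _, fun p hp _ => ?_⟩
  set T := (Finset.range (p + 1)).filter (fun q => q ∈ S) with hT
  have hTp : ∀ q ∈ T, q.Prime ∧ q ≤ p := fun q hq => by
    rw [hT, Finset.mem_filter, Finset.mem_range] at hq
    exact ⟨hS q hq.2, by lia⟩
  have hlow : Real.log p / 2 - c₀ ≤ ∑ q ∈ T, Real.log q / q := by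
    have h := hmertens p (by exact_mod_cast hp.two_le)
    have hfilter : (Finset.range (⌊(p : ℝ)⌋₊ + 1)).filter
        (fun q => q ∈ S ∧ (q : ℝ) ≤ p) = T := by
      ext q
      simp only [hT, Nat.floor_natCast, Finset.mem_filter, Finset.mem_range, Nat.cast_le]
      grind
    rw [hfilter] at h
    linarith [(abs_le.1 h).1]
  have htheta : ∑ q ∈ T, Real.log q ≤ Real.log 4 * p := sum_log_le_log_four_mul hTp
  have hp0 : (0 : ℝ) < p := by exact_mod_cast hp.pos
  have hfac : ∀ q ∈ T, (0 : ℝ) < (q : ℝ) ^ (p * q / (q ^ 2 - 1) - 1) := fun q hq =>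
    pow_pos (by exact_mod_cast (hTp q hq).1.pos) _
  have hterm : (p : ℝ) * ∑ q ∈ T, Real.log q / q - 2 * ∑ q ∈ T, Real.log q ≤
      ∑ q ∈ T, Real.log ((q : ℝ) ^ (p * q / (q ^ 2 - 1) - 1)) := by
    rw [Finset.mul_sum, Finset.mul_sum, ← Finset.sum_sub_distrib]
    refine Finset.sum_le_sum fun q hq => ?_
    rw [Real.log_pow]
    calc (p : ℝ) * (Real.log q / q) - 2 * Real.log q = (p / q - 2) * Real.log q := by ring
      _ ≤ _ := mul_le_mul_of_nonneg_right
        (div_sub_two_le_natDiv_sub_one p (hTp q hq).1.two_le) (Real.log_natCast_nonneg q)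
  have hmul := mul_le_mul_of_nonneg_left hlow hp0.le
  rw [ge_iff_le, ← Real.exp_nat_mul, Real.rpow_def_of_pos hp0, ← Real.exp_sub,
    ← Real.le_log_iff_exp_le (Finset.prod_pos hfac), Real.log_prod fun q hq => (hfac q hq).ne']
  linarith
end

section
/- Let q be a prime number, R a commutative ring, M an R-module, ∂ : M → M an additive map, and X ⊆ M an additive subgroup such that: (i) for every r ∈ X there exists r′ ∈ X with ∂^{q²−1} r = q^q · r′ (where q denotes the image of the natural number q in R); and (ii) for every r ∈ X and every natural number a with a < q² − 1 there exists m ∈ M with ∂^a r = q^{v_q(a!)} · m, where v_q(a!) denotes the q-adic valuation of a!. Then for every r ∈ X and every natural number n there exists m ∈ M with ∂^n r = q^{⌊nq/(q²−1)⌋} · m. -/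
theorem iterate_natCast_pow_smul {R M : Type*} [CommRing R] [AddCommGroup M] [Module R M]
    {d : M → M} (hd : ∀ x y : M, d (x + y) = d x + d y) (q k n : ℕ) (m : M) :
    d^[n] ((q : R) ^ k • m) = (q : R) ^ k • d^[n] m := by
  have h (x : M) : d ((q : R) ^ k • x) = (q : R) ^ k • d x := by
    simp only [← Nat.cast_pow, Nat.cast_smul_eq_nsmul]
    exact map_nsmul (AddMonoidHom.mk' d hd) (q ^ k) x
  exact (Function.Commute.iterate_left h n) m

theorem mul_div_sq_sub_one_eq_div {q a : ℕ} (hq : 2 ≤ q) (ha : a < q ^ 2 - 1) :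
    a * q / (q ^ 2 - 1) = a / q := by
  obtain ⟨N, hN⟩ : ∃ N, q ^ 2 = N + 1 := Nat.exists_eq_add_one.2 (by positivity)
  rw [hN, Nat.add_sub_cancel] at ha ⊢
  have hmod : a % q < q := Nat.mod_lt _ (by omega)
  have hc : a / q < q := Nat.div_lt_of_lt_mul (by nlinarith)
  have hdecomp := Nat.div_add_mod a q
  generalize a / q = c at *
  generalize a % q = e at *
  have hrem : c + e * q < N := by
    rcases Nat.lt_or_ge (e + 1) q with he | he
    · nlinarith
    · obtain rfl : q = e + 1 := by omega
      have : c < e := by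
        by_contra h
        obtain rfl : c = e := by omega
        nlinarith
      nlinarith
  rw [← hdecomp, Nat.div_eq_iff (by omega)]
  constructor
  · nlinarith
  · have : (q * c + e) * q = c * N + (c + e * q) := by linear_combination c * hN
    omega

theorem div_le_padicValNat_factorial {q : ℕ} (hq : q.Prime) (a : ℕ) :
    a / q ≤ padicValNat q a.factorial := by
  have := Fact.mk hq
  rw [← padicValNat_mul_div_factorial, padicValNat_factorial_mul]
  exact Nat.le_add_left _ _


/-- inductive step in Lemma 2.8 of the paper, after Katz.  Let `q` be a
prime, `M` an `R`-module, `d : M → M` additive, and `X ⊆ M` an additive subgroup such that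
(i) for every `r ∈ X` there is `r' ∈ X` with `d^(q²-1) r = q^q • r'`, and (ii) for every
`r ∈ X` and every `a < q² - 1` there is `m ∈ M` with `d^a r = q^(v_q(a!)) • m`.  Then for
every `r ∈ X` and every `n` there is `m ∈ M` with `d^n r = q^⌊nq/(q²-1)⌋ • m`. -/
theorem stmt7 (q : ℕ) (hq : q.Prime)
    (R : Type*) [CommRing R] (M : Type*) [AddCommGroup M] [Module R M]
    (d : M → M) (hd : ∀ x y : M, d (x + y) = d x + d y)
    (X : AddSubgroup M)
    (hi : ∀ r ∈ X, ∃ r' ∈ X, d^[q ^ 2 - 1] r = ((q : R) ^ q) • r')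
    (hii : ∀ r ∈ X, ∀ a : ℕ, a < q ^ 2 - 1 →
      ∃ m : M, d^[a] r = ((q : R) ^ (padicValNat q (Nat.factorial a))) • m) :
    ∀ r ∈ X, ∀ n : ℕ, ∃ m : M, d^[n] r = ((q : R) ^ (n * q / (q ^ 2 - 1))) • m := by
  have hq2 : 0 < q ^ 2 - 1 := by
    have := hq.two_le
    have : 2 ^ 2 ≤ q ^ 2 := Nat.pow_le_pow_left this 2
    omega
  intro r hr n
  induction n using Nat.strong_induction_on generalizing r with
  | h n ih =>
    rcases Nat.lt_or_ge n (q ^ 2 - 1) with hn | hn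
    · obtain ⟨m, hm⟩ := hii r hr n hn
      have hle := div_le_padicValNat_factorial hq n
      rw [← mul_div_sq_sub_one_eq_div hq.two_le hn] at hle
      obtain ⟨k, hk⟩ := Nat.exists_eq_add_of_le hle
      exact ⟨(q : R) ^ k • m, by rw [hm, hk, pow_add, mul_smul]⟩
    · obtain ⟨k, rfl⟩ := Nat.exists_eq_add_of_le' hn
      obtain ⟨r', hr', h⟩ := hi r hr
      obtain ⟨m, hm⟩ := ih k (by omega) r' hr'
      refine ⟨m, ?_⟩
      rw [Function.iterate_add_apply, h, iterate_natCast_pow_smul hd, hm, ← mul_smul, ← pow_add,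
        add_mul, Nat.add_mul_div_left _ _ hq2, add_comm q]
end

section
/- Let U ⊆ ℂ be an open set, D an integer, and W, V : ℂ → ℂ functions which are infinitely differentiable on U and satisfy, at every point of U, W′ = V, V′ = 2W³, and V² = W⁴ − D. Then for every natural number n ≥ 0 there exists a polynomial A_n(X) with integer coefficients, of degree exactly 2n + 3, such that the (2n+1)-st derivative of V equals A_n(W) at every point of U. -/
open Polynomial in
/-- If `W′ = V`, `V′ = 2W³` and `V² = W⁴ - D`, the second derivative of `A(W)` is
`(weierstrassStep D A)(W)`. -/
noncomputable def weierstrassStep (D : ℤ) (A : ℤ[X]) : ℤ[X] :=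
  derivative (derivative A) * (X ^ 4 - C D) + derivative A * (C 2 * X ^ 3)

open Polynomial in
theorem natDegree_weierstrassStep (D : ℤ) (A : ℤ[X]) (m : ℕ) (hA : A.natDegree = m + 2) :
    (weierstrassStep D A).natDegree = m + 4 := by
  have h1 : (derivative A).natDegree ≤ m + 1 :=
    (natDegree_derivative_le A).trans (by omega)
  have h2 : (derivative (derivative A)).natDegree ≤ m :=
    (natDegree_derivative_le _).trans (by omega)
  have hlead : A.coeff (m + 2) ≠ 0 := by
    rw [← hA, coeff_natDegree, Ne, leadingCoeff_eq_zero]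
    rintro rfl
    simp at hA
  refine natDegree_eq_of_le_of_coeff_ne_zero ?_ ?_
  · refine natDegree_add_le_of_degree_le ?_ ?_
    · exact natDegree_mul_le_of_le h2 (by compute_degree)
    · exact natDegree_mul_le_of_le (m := m + 1) (n := 3) h1 (by compute_degree)
  · have hz : (derivative (derivative A)).coeff (m + 4) = 0 :=
      coeff_eq_zero_of_natDegree_lt (by omega)
    have hc : (weierstrassStep D A).coeff (m + 4) =
        A.coeff (m + 2) * (((m : ℤ) + 2) * (m + 3)) := by
      have e1 : (derivative (derivative A) * X ^ 4).coeff (m + 4) =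
          (derivative (derivative A)).coeff m := coeff_mul_X_pow _ _ _
      have e2 : (derivative A * C 2 * X ^ 3).coeff (m + 4) =
          (derivative A * C 2).coeff (m + 1) := coeff_mul_X_pow _ 3 (m + 1)
      rw [weierstrassStep, mul_sub, ← mul_assoc, coeff_add, coeff_sub, e1, e2, coeff_mul_C,
        coeff_mul_C, hz, coeff_derivative, coeff_derivative]
      push_cast
      ring
    rw [hc]
    exact mul_ne_zero hlead (by positivity)

theorem iteratedDeriv_add_two_eq_aeval_weierstrassStep {U : Set ℂ} (hU : IsOpen U) {D : ℤ}
    {W V f : ℂ → ℂ}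
    (hW : ∀ z ∈ U, HasDerivAt W (V z) z) (hV : ∀ z ∈ U, HasDerivAt V (2 * W z ^ 3) z)
    (hVW : ∀ z ∈ U, V z ^ 2 = W z ^ 4 - (D : ℂ)) {k : ℕ} {A : Polynomial ℤ}
    (hA : ∀ z ∈ U, iteratedDeriv k f z = Polynomial.aeval (W z) A) :
    ∀ z ∈ U, iteratedDeriv (k + 2) f z = Polynomial.aeval (W z) (weierstrassStep D A) := by
  have hcomp : ∀ (B : Polynomial ℤ), ∀ z ∈ U, HasDerivAt (fun z => Polynomial.aeval (W z) B)
      (Polynomial.aeval (W z) (Polynomial.derivative B) * V z) z := fun B z hz =>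
    (B.hasDerivAt_aeval (W z)).comp z (hW z hz)
  have h1 : ∀ z ∈ U, iteratedDeriv (k + 1) f z =
      Polynomial.aeval (W z) (Polynomial.derivative A) * V z := fun z hz => by
    rw [iteratedDeriv_succ, Filter.EventuallyEq.deriv_eq
      (Filter.eventually_of_mem (hU.mem_nhds hz) hA)]
    exact (hcomp A z hz).deriv
  intro z hz
  rw [iteratedDeriv_succ, Filter.EventuallyEq.deriv_eq
    (Filter.eventually_of_mem (hU.mem_nhds hz) h1)]
  refine ((hcomp _ z hz).mul (hV z hz)).deriv.trans ?_
  rw [mul_assoc, ← sq, hVW z hz]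
  simp [weierstrassStep, map_ofNat (Polynomial.aeval (W z))]

/-- Lemma 4.3 of the paper.  Let `U ⊆ ℂ` be open, `D ∈ ℤ`, and
`W, V : ℂ → ℂ` infinitely differentiable on `U` with `W′ = V`, `V′ = 2W³` and
`V² = W⁴ - D` on `U`.  Then for every `n ≥ 0` there is a polynomial `Aₙ ∈ ℤ[X]` of degree
exactly `2n + 3` with `V^(2n+1) = Aₙ(W)` on `U`. -/
theorem stmt12 (U : Set ℂ) (hU : IsOpen U) (D : ℤ) (W V : ℂ → ℂ)
    (hW : ContDiffOn ℂ ⊤ W U) (hV : ContDiffOn ℂ ⊤ V U)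
    (hWV : ∀ z ∈ U, deriv W z = V z)
    (hV' : ∀ z ∈ U, deriv V z = 2 * (W z) ^ 3)
    (hVW : ∀ z ∈ U, (V z) ^ 2 = (W z) ^ 4 - (D : ℂ)) :
    ∀ n : ℕ, ∃ A : Polynomial ℤ, A.degree = 2 * n + 3 ∧
      ∀ z ∈ U, iteratedDeriv (2 * n + 1) V z = Polynomial.aeval (W z) A := by
  have hW' : ∀ z ∈ U, HasDerivAt W (V z) z := fun z hz =>
    hWV z hz ▸ ((hW.differentiableOn (by simp)).differentiableAt (hU.mem_nhds hz)).hasDerivAt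
  have hV'' : ∀ z ∈ U, HasDerivAt V (2 * W z ^ 3) z := fun z hz =>
    hV' z hz ▸ ((hV.differentiableOn (by simp)).differentiableAt (hU.mem_nhds hz)).hasDerivAt
  suffices h : ∀ n : ℕ, ∃ A : Polynomial ℤ, A.natDegree = 2 * n + 3 ∧
      ∀ z ∈ U, iteratedDeriv (2 * n + 1) V z = Polynomial.aeval (W z) A by
    intro n
    obtain ⟨A, hA, hAW⟩ := h n
    refine ⟨A, ?_, hAW⟩
    rw [(Polynomial.degree_eq_iff_natDegree_eq_of_pos (by omega)).2 hA]
    push_cast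
    rfl
  intro n
  induction n with
  | zero =>
    refine ⟨Polynomial.C 2 * Polynomial.X ^ 3, Polynomial.natDegree_C_mul_X_pow 3 2 two_ne_zero,
      fun z hz => ?_⟩
    simp [iteratedDeriv_one, hV' z hz, map_ofNat (Polynomial.aeval (W z))]
  | succ n ih =>
    obtain ⟨A, hA, hAW⟩ := ih
    exact ⟨weierstrassStep D A, natDegree_weierstrassStep D A (2 * n + 1) hA,
      iteratedDeriv_add_two_eq_aeval_weierstrassStep hU hW' hV'' hVW hAW⟩
end
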